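/- arXiv:1502.01074 — 8 statements merged into one kernel-verified Lean document; each statement's English description precedes it below -/
import Mathlib

section
/- Let G = (V,E) be a rooted simple directed graph on n vertices and let w ∈ Sp[V]. Then the set of w-feasible dynamics 𝔸_G(w) is nonempty if and only if the support V_w = {i ∈ V : w_i ≠ 0} is a relevant subset of G. Equivalently, the set W of all w ∈ Sp[V] for which 𝔸_G(w) is nonempty equals the union ∪_{i=1}^q Sp(V_i), where V_1,…,V_q are the relevant subsets of G and Sp(V') := {w ∈ Sp[V] : w_i > 0 for i ∈ V', w_i = 0 for i ∉ V'}. -/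
open Matrix Finset
open scoped Classical

noncomputable section

/-- `A` is an infinitesimal stochastic matrix (ISM): all off-diagonal entries are
nonnegative and every row sums to zero. -/
def IsISM {n : ℕ} (A : Matrix (Fin n) (Fin n) ℝ) : Prop :=
  (∀ i j, i ≠ j → 0 ≤ A i j) ∧ ∀ i, ∑ j, A i j = 0

/-- `A` has the zero pattern prescribed by the digraph with edge relation `E`:
`A i j = 0` whenever `i ≠ j` and `i → j` is not an edge. -/
def InPattern {n : ℕ} (E : Fin n → Fin n → Prop) (A : Matrix (Fin n) (Fin n) ℝ) : Prop :=
  ∀ i j, i ≠ j → ¬ E i j → A i j = 0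

/-- `r` is a root of the digraph `E`: every vertex has a directed path to `r`. -/
def IsRootOf {n : ℕ} (E : Fin n → Fin n → Prop) (r : Fin n) : Prop :=
  ∀ i, Relation.ReflTransGen E i r

/-- The digraph `E` is rooted. -/
def Rooted {n : ℕ} (E : Fin n → Fin n → Prop) : Prop :=
  ∃ r, IsRootOf E r

/-- `w` lies in the standard simplex `Sp[V]`. -/
def MemSimplex {n : ℕ} (w : Fin n → ℝ) : Prop :=
  (∀ i, 0 ≤ w i) ∧ ∑ i, w i = 1

/-- `0` is a simple eigenvalue of `A`: it is a root of multiplicity exactly one of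
the characteristic polynomial of `A`. -/
def SimpleZeroEig {n : ℕ} (A : Matrix (Fin n) (Fin n) ℝ) : Prop :=
  Polynomial.rootMultiplicity 0 (Matrix.charpoly A) = 1

/-- `A ∈ 𝔸_G(w)`: the set of `w`-feasible dynamics. -/
def Feasible {n : ℕ} (E : Fin n → Fin n → Prop) (w : Fin n → ℝ)
    (A : Matrix (Fin n) (Fin n) ℝ) : Prop :=
  IsISM A ∧ InPattern E A ∧ SimpleZeroEig A ∧ Aᵀ *ᵥ w = 0

/-- `S` is a relevant subset of the digraph `E`: it consists of roots and the induced
subgraph on `S` is strongly connected (paths staying inside `S`). -/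
def RelevantSubset {n : ℕ} (E : Fin n → Fin n → Prop) (S : Set (Fin n)) : Prop :=
  (∀ i ∈ S, IsRootOf E i) ∧
    ∀ i ∈ S, ∀ j ∈ S, Relation.ReflTransGen (fun a b => E a b ∧ a ∈ S ∧ b ∈ S) i j

theorem transpose_mulVec_eq_zero_iff {n : ℕ} (A : Matrix (Fin n) (Fin n) ℝ) (w : Fin n → ℝ) :
    Aᵀ *ᵥ w = 0 ↔ ∀ j, ∑ i, w i * A i j = 0 := by
  simp only [funext_iff, Matrix.mulVec, dotProduct, Matrix.transpose_apply, Pi.zero_apply,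
    mul_comm]

/-- The edges of the weighted digraph of `A`. -/
def PosEntry {n : ℕ} (A : Matrix (Fin n) (Fin n) ℝ) (i j : Fin n) : Prop :=
  i ≠ j ∧ 0 < A i j

theorem IsISM.eq_zero_of_not_posEntry {n : ℕ} {A : Matrix (Fin n) (Fin n) ℝ} (hA : IsISM A)
    {i j : Fin n} (hij : i ≠ j) (h : ¬ PosEntry A i j) : A i j = 0 :=
  le_antisymm (not_lt.1 fun h' => h ⟨hij, h'⟩) (hA.1 i j hij)

theorem PosEntry.edge {n : ℕ} {E : Fin n → Fin n → Prop} {A : Matrix (Fin n) (Fin n) ℝ}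
    (hA : InPattern E A) {i j : Fin n} (h : PosEntry A i j) : E i j := by
  by_contra hE
  exact h.2.ne' (hA i j h.1 hE)

/-- If zero is a simple eigenvalue, the left null space is a line. -/
theorem SimpleZeroEig.exists_smul_eq {n : ℕ} {A : Matrix (Fin n) (Fin n) ℝ}
    (hA : SimpleZeroEig A) {w v : Fin n → ℝ} (hw0 : w ≠ 0) (hw : Aᵀ *ᵥ w = 0)
    (hv : Aᵀ *ᵥ v = 0) : ∃ c : ℝ, c • w = v := by
  have h1 : Module.finrank ℝ (Module.End.maxGenEigenspace (Matrix.toLin' Aᵀ) 0) = 1 := by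
    rw [LinearMap.finrank_maxGenEigenspace_eq, Matrix.charpoly_toLin', Matrix.charpoly_transpose]
    exact hA
  have mem : ∀ x : Fin n → ℝ, Aᵀ *ᵥ x = 0 → x ∈ Module.End.maxGenEigenspace (Matrix.toLin' Aᵀ) 0 := by
    intro x hx
    rw [Module.End.mem_maxGenEigenspace]
    exact ⟨1, by simpa using hx⟩
  obtain ⟨c, hc⟩ := (finrank_eq_one_iff_of_nonzero'
    (⟨w, mem w hw⟩ : Module.End.maxGenEigenspace (Matrix.toLin' Aᵀ) 0)
    (fun h => hw0 (congrArg Subtype.val h))).1 h1 ⟨v, mem v hv⟩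
  exact ⟨c, congrArg Subtype.val hc⟩

/-- A set of vertices closed under the edges of `A` supports a nonzero left null vector. -/
theorem IsISM.exists_left_null_of_closed {n : ℕ} {A : Matrix (Fin n) (Fin n) ℝ} (hA : IsISM A)
    {T : Set (Fin n)} (hne : T.Nonempty) (hT : ∀ i ∈ T, ∀ j ∉ T, A i j = 0) :
    ∃ v : Fin n → ℝ, v ≠ 0 ∧ (∀ i ∉ T, v i = 0) ∧ Aᵀ *ᵥ v = 0 := by
  set B : Matrix (Fin n) (Fin n) ℝ :=
    Matrix.of fun i j => if i ∈ T then A i j else if i = j then 1 else 0 with hB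
  have hdet : B.det = 0 := by
    rw [← Matrix.exists_mulVec_eq_zero_iff]
    refine ⟨fun j => if j ∈ T then 1 else 0, ?_, ?_⟩
    · obtain ⟨t, ht⟩ := hne
      intro h
      simpa [ht] using congrFun h t
    · ext i
      simp only [Matrix.mulVec, dotProduct, hB, Matrix.of_apply, Pi.zero_apply]
      by_cases hi : i ∈ T
      · rw [← hA.2 i]
        refine Finset.sum_congr rfl fun j _ => ?_
        by_cases hj : j ∈ T
        · simp [hi, hj]
        · simp [hi, hj, hT i hi j hj]
      · refine Finset.sum_eq_zero fun j _ => ?_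
        by_cases hij : i = j
        · subst hij; simp [hi]
        · simp [hi, hij]
  obtain ⟨v, hv0, hv⟩ := Matrix.exists_vecMul_eq_zero_iff.2 hdet
  have hcol : ∀ j, ∑ i, v i * B i j = 0 := fun j => congrFun hv j
  have hsupp : ∀ j ∉ T, v j = 0 := by
    intro j hj
    rw [← hcol j, Finset.sum_eq_single j]
    · simp [hB, hj]
    · intro i _ hij
      by_cases hi : i ∈ T
      · simp [hB, hi, hT i hi j hj]
      · simp [hB, hi, hij]
    · simp
  refine ⟨v, hv0, hsupp, (transpose_mulVec_eq_zero_iff A v).2 fun j => ?_⟩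
  rw [← hcol j]
  refine Finset.sum_congr rfl fun i _ => ?_
  by_cases hi : i ∈ T
  · simp [hB, hi]
  · simp [hsupp i hi]

/-- The support of a nonnegative left null vector of an ISM is closed under its edges. -/
theorem IsISM.support_closed {n : ℕ} {A : Matrix (Fin n) (Fin n) ℝ} (hA : IsISM A)
    {w : Fin n → ℝ} (hw : ∀ i, 0 ≤ w i) (hnull : Aᵀ *ᵥ w = 0) {i j : Fin n}
    (hi : w i ≠ 0) (hj : w j = 0) : A i j = 0 := by
  have hsum := (transpose_mulVec_eq_zero_iff A w).1 hnull j
  have hnn : ∀ k ∈ Finset.univ, 0 ≤ w k * A k j := by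
    intro k _
    by_cases hkj : k = j
    · simp [hkj, hj]
    · exact mul_nonneg (hw k) (hA.1 k j hkj)
  exact (mul_eq_zero.1 ((Finset.sum_eq_zero_iff_of_nonneg hnn).1 hsum i
    (Finset.mem_univ i))).resolve_left hi

theorem Feasible.relevantSubset_support {n : ℕ} {E : Fin n → Fin n → Prop} {w : Fin n → ℝ}
    {A : Matrix (Fin n) (Fin n) ℝ} (hw : MemSimplex w) (h : Feasible E w A) :
    RelevantSubset E {i | w i ≠ 0} := by
  obtain ⟨hA, hpat, hsimple, hnull⟩ := h
  have hw0 : w ≠ 0 := by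
    rintro rfl
    simpa using hw.2
  -- Any nonempty closed set contains the whole support.
  have key : ∀ T : Set (Fin n), T.Nonempty → (∀ i ∈ T, ∀ j, PosEntry A i j → j ∈ T) →
      ∀ s, w s ≠ 0 → s ∈ T := by
    intro T hne hT s hs
    obtain ⟨v, hv0, hsupp, hv⟩ := hA.exists_left_null_of_closed hne fun i hi j hj =>
      hA.eq_zero_of_not_posEntry (fun hij => hj (hij ▸ hi)) fun hp => hj (hT i hi j hp)
    obtain ⟨c, rfl⟩ := hsimple.exists_smul_eq hw0 hnull hv
    by_contra hsT
    have hc : c = 0 := by simpa [hs] using hsupp s hsT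
    exact hv0 (by simp [hc])
  refine ⟨fun s hs i => ?_, fun s hs t ht => ?_⟩
  · exact (key {j | Relation.ReflTransGen E i j} ⟨i, .refl⟩
      (fun j hj k hjk => Relation.ReflTransGen.tail hj (hjk.edge hpat))) s hs
  · refine (key {j | w j ≠ 0 ∧ Relation.ReflTransGen
      (fun a b => E a b ∧ a ∈ {i | w i ≠ 0} ∧ b ∈ {i | w i ≠ 0}) s j} ⟨s, hs, .refl⟩
      (fun j hj k hjk => ?_) t ht).2
    have hk : w k ≠ 0 := fun hk => hjk.2.ne' (hA.support_closed hw.1 hnull hj.1 hk)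
    exact ⟨hk, hj.2.tail ⟨hjk.edge hpat, hj.1, hk⟩⟩

/-- Maximum principle: a function with constant Laplacian `c` has `c ≤ 0`, and if `c = 0` its
maximum is attained at any vertex reachable from all the others. -/
theorem IsISM.le_of_mulVec_eq_const {n : ℕ} {A : Matrix (Fin n) (Fin n) ℝ} (hA : IsISM A)
    {s : Fin n} (hs : ∀ i, Relation.ReflTransGen (PosEntry A) i s) {x : Fin n → ℝ} {c : ℝ}
    (hx : ∀ i, ∑ j, A i j * x j = c) : c ≤ 0 ∧ (c = 0 → ∀ i, x i ≤ x s) := by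
  have : Nonempty (Fin n) := ⟨s⟩
  obtain ⟨m, hm⟩ := Finite.exists_max x
  have hx' : ∀ i, ∑ j, A i j * (x j - x i) = c := by
    intro i
    simp only [mul_sub, Finset.sum_sub_distrib, ← Finset.sum_mul, hA.2 i, hx i]
    ring
  have hterm : ∀ i, x i = x m → ∀ j ∈ Finset.univ, A i j * (x j - x i) ≤ 0 := by
    intro i hi j _
    by_cases hij : i = j
    · simp [hij]
    · exact mul_nonpos_of_nonneg_of_nonpos (hA.1 i j hij) (by linarith [hm j])
  refine ⟨?_, fun hc i => ?_⟩
  · rw [← hx' m]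
    exact Finset.sum_nonpos (hterm m rfl)
  · have hreach : ∀ k, Relation.ReflTransGen (PosEntry A) m k → x k = x m := by
      intro k hk
      induction hk with
      | refl => rfl
      | @tail a b _ hab ih =>
        have h0 := (Finset.sum_eq_zero_iff_of_nonpos (hterm _ ih)).1 ((hx' a).trans hc) b
          (Finset.mem_univ b)
        have := (mul_eq_zero.1 h0).resolve_left hab.2.ne'
        linarith
    rw [hreach s (hs m)]
    exact hm i

theorem IsISM.eq_of_mulVec_eq_const {n : ℕ} {A : Matrix (Fin n) (Fin n) ℝ} (hA : IsISM A)
    {s : Fin n} (hs : ∀ i, Relation.ReflTransGen (PosEntry A) i s) {x : Fin n → ℝ} {c : ℝ}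
    (hx : ∀ i, ∑ j, A i j * x j = c) : c = 0 ∧ ∀ i, x i = x s := by
  have h1 := hA.le_of_mulVec_eq_const hs hx
  have h2 := hA.le_of_mulVec_eq_const (x := -x) (c := -c) hs (by simp [hx])
  have hc : c = 0 := by linarith [h1.1, h2.1]
  refine ⟨hc, fun i => le_antisymm (h1.2 hc i) ?_⟩
  simpa using h2.2 (by simp [hc]) i

/-- If some vertex is reachable from all the others, then zero is a simple eigenvalue. -/
theorem IsISM.simpleZeroEig {n : ℕ} {A : Matrix (Fin n) (Fin n) ℝ} (hA : IsISM A)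
    {s : Fin n} (hs : ∀ i, Relation.ReflTransGen (PosEntry A) i s) : SimpleZeroEig A := by
  have hpow : ∀ (k : ℕ) (x : Fin n → ℝ), ((Matrix.toLin' A) ^ k) x = 0 → ∀ i, x i = x s := by
    intro k
    induction k with
    | zero =>
      intro x hx i
      have : x = 0 := by simpa using hx
      simp [this]
    | succ k ih =>
      intro x hx
      rw [pow_succ, Module.End.mul_apply] at hx
      exact (hA.eq_of_mulVec_eq_const hs fun i => ih _ hx i).2
  unfold SimpleZeroEig
  rw [← Matrix.charpoly_toLin', ← LinearMap.finrank_maxGenEigenspace_eq]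
  have h1 : (1 : Fin n → ℝ) ∈ Module.End.maxGenEigenspace (Matrix.toLin' A) 0 := by
    rw [Module.End.mem_maxGenEigenspace]
    refine ⟨1, ?_⟩
    ext i
    simpa [Matrix.mulVec, dotProduct] using hA.2 i
  refine finrank_eq_one ⟨1, h1⟩ (fun h => ?_) fun x => ⟨x.1 s, ?_⟩
  · simpa using congrFun (congrArg Subtype.val h) s
  · obtain ⟨k, hk⟩ := (Module.End.mem_maxGenEigenspace _ _ _).1 x.2
    ext i
    simpa using (hpow k x.1 (by simpa using hk) i).symm

/-- A path carries a unit flow from its start to its end. -/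
theorem exists_flow_of_reflTransGen {V : Type*} [Fintype V] {R : V → V → Prop} {x y : V}
    (h : Relation.ReflTransGen R x y) :
    ∃ f : V → V → ℝ, (∀ a b, 0 ≤ f a b) ∧ (∀ a b, ¬ R a b → f a b = 0) ∧
      ∀ v, ∑ u, f v u - ∑ u, f u v = (if v = x then 1 else 0) - (if v = y then 1 else 0) := by
  induction h with
  | refl => exact ⟨0, by simp⟩
  | @tail b c _ hbc ih =>
    obtain ⟨f, hf0, hfR, hf⟩ := ih
    refine ⟨fun u v => f u v + if u = b ∧ v = c then 1 else 0, fun u v => ?_, fun u v huv => ?_,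
      fun v => ?_⟩
    · have := hf0 u v
      positivity
    · beta_reduce
      rw [hfR u v huv, if_neg, add_zero]
      rintro ⟨rfl, rfl⟩
      exact huv hbc
    · have hout : ∑ u, (if v = b ∧ u = c then (1 : ℝ) else 0) = if v = b then 1 else 0 := by
        by_cases hv : v = b <;> simp [hv]
      have hin : ∑ u, (if u = b ∧ v = c then (1 : ℝ) else 0) = if v = c then 1 else 0 := by
        by_cases hv : v = c <;> simp [hv]
      rw [Finset.sum_add_distrib, Finset.sum_add_distrib, hout, hin]
      linarith [hf v]

/-- If every edge can be closed to a cycle, there is a circulation positive on all edges. -/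
theorem exists_pos_circulation {V : Type*} [Fintype V] {R : V → V → Prop}
    (hR : ∀ a b, R a b → Relation.ReflTransGen R b a) :
    ∃ f : V → V → ℝ, (∀ a b, 0 ≤ f a b) ∧ (∀ a b, ¬ R a b → f a b = 0) ∧
      (∀ a b, R a b → 0 < f a b) ∧ ∀ v, ∑ u, f v u = ∑ u, f u v := by
  have hcycle : ∀ p : V × V, ∃ g : V → V → ℝ, (∀ a b, 0 ≤ g a b) ∧
      (∀ a b, ¬ R a b → g a b = 0) ∧ (R p.1 p.2 → 0 < g p.1 p.2) ∧
      ∀ v, ∑ u, g v u = ∑ u, g u v := by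
    rintro ⟨x, y⟩
    by_cases hxy : R x y
    · obtain ⟨f, hf0, hfR, hf⟩ := exists_flow_of_reflTransGen (hR x y hxy)
      refine ⟨fun u v => f u v + if u = x ∧ v = y then 1 else 0, fun u v => ?_,
        fun u v huv => ?_, fun _ => ?_, fun v => ?_⟩
      · have := hf0 u v
        positivity
      · beta_reduce
        rw [hfR u v huv, if_neg, add_zero]
        rintro ⟨rfl, rfl⟩
        exact huv hxy
      · have := hf0 x y
        simp only [and_self, if_true]
        linarith
      · have hout : ∑ u, (if v = x ∧ u = y then (1 : ℝ) else 0) = if v = x then 1 else 0 := by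
          by_cases hv : v = x <;> simp [hv]
        have hin : ∑ u, (if u = x ∧ v = y then (1 : ℝ) else 0) = if v = y then 1 else 0 := by
          by_cases hv : v = y <;> simp [hv]
        rw [Finset.sum_add_distrib, Finset.sum_add_distrib, hout, hin]
        linarith [hf v]
    · exact ⟨0, by simp [hxy]⟩
  choose g hg0 hgR hgpos hg using hcycle
  refine ⟨fun a b => ∑ p, g p a b, fun a b => Finset.sum_nonneg fun p _ => hg0 p a b,
    fun a b hab => Finset.sum_eq_zero fun p _ => hgR p a b hab, fun a b hab => ?_, fun v => ?_⟩
  · exact Finset.sum_pos' (fun p _ => hg0 p a b) ⟨(a, b), Finset.mem_univ _, hgpos (a, b) hab⟩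
  · rw [Finset.sum_comm, Finset.sum_comm (f := fun u p => g p u v)]
    exact Finset.sum_congr rfl fun p _ => hg p v

theorem RelevantSubset.exists_feasible {n : ℕ} {E : Fin n → Fin n → Prop}
    (hsimple : ∀ i, ¬ E i i) {w : Fin n → ℝ} (hw : MemSimplex w)
    (h : RelevantSubset E {i | w i ≠ 0}) : ∃ A, Feasible E w A := by
  obtain ⟨hroot, hconn⟩ := h
  obtain ⟨s, hs⟩ : ∃ s, w s ≠ 0 := by
    by_contra! h0
    simpa [h0] using hw.2
  obtain ⟨f, hf0, hfR, hfpos, hf⟩ := exists_pos_circulation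
    (R := fun a b => E a b ∧ a ∈ {i | w i ≠ 0} ∧ b ∈ {i | w i ≠ 0})
    fun a b hab => hconn b hab.2.2 a hab.2.1
  set B : Fin n → Fin n → ℝ :=
    fun i j => if w i = 0 then (if E i j then 1 else 0) else f i j / w i with hB
  set A : Matrix (Fin n) (Fin n) ℝ :=
    Matrix.of fun i j => B i j - if i = j then ∑ k, B i k else 0 with hAdef
  have hAB : ∀ i j, i ≠ j → A i j = B i j := fun i j hij => by simp [hAdef, hij]
  have hwB : ∀ i j, w i * B i j = f i j := by
    intro i j
    by_cases hi : w i = 0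
    · simp [hi, hfR i j fun h => h.2.1 hi]
    · simp only [hB, hi, if_false]
      field_simp
  have hISM : IsISM A := by
    refine ⟨fun i j hij => ?_, fun i => ?_⟩
    · rw [hAB i j hij, hB]
      by_cases hi : w i = 0
      · simp only [hi, if_true]
        positivity
      · simpa only [hi, if_false] using div_nonneg (hf0 i j) (hw.1 i)
    · simp [hAdef]
  have hedge : ∀ i j, E i j → (w i ≠ 0 → w j ≠ 0) → PosEntry A i j := by
    intro i j hij hw'
    have hne : i ≠ j := fun h => hsimple i (h ▸ hij)
    refine ⟨hne, ?_⟩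
    rw [hAB i j hne, hB]
    by_cases hi : w i = 0
    · simp [hi, hij]
    · simpa only [hi, if_false] using
        div_pos (hfpos i j ⟨hij, hi, hw' hi⟩) (lt_of_le_of_ne (hw.1 i) (Ne.symm hi))
  refine ⟨A, hISM, fun i j hij hE => ?_, hISM.simpleZeroEig (s := s) fun i => ?_,
    (transpose_mulVec_eq_zero_iff A w).2 fun j => ?_⟩
  · rw [hAB i j hij]
    simp [hB, hE, hfR i j fun h => hE h.1]
  · induction hroot s hs i using Relation.ReflTransGen.head_induction_on with
    | refl => exact .refl
    | @head a c hac _ ih =>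
      by_cases ha : w a = 0
      · exact ih.head (hedge a c hac fun h => absurd ha h)
      · exact (hconn a ha s hs).lift id fun a b hab => hedge a b hab.1 fun _ => hab.2.2
  · have hj : w j * ∑ k, B j k = ∑ k, f k j := by
      rw [← hf j, Finset.mul_sum]
      exact Finset.sum_congr rfl fun k _ => hwB j k
    simp [hAdef, mul_sub, hwB, hj]

/-- Theorem 1 (main theorem): over a rooted simple digraph, the set of `w`-feasible
dynamics `𝔸_G(w)` is nonempty iff the support of `w` is a relevant subset of `G`. -/
theorem feasible_nonempty_iff_support_relevant
    (n : ℕ) (hn : 1 ≤ n) (E : Fin n → Fin n → Prop) (hsimple : ∀ i, ¬ E i i)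
    (hrooted : Rooted E) (w : Fin n → ℝ) (hw : MemSimplex w) :
    (∃ A, Feasible E w A) ↔ RelevantSubset E {i | w i ≠ 0} := by
  exact ⟨fun ⟨_, hA⟩ => hA.relevantSubset_support hw, fun h => h.exists_feasible hsimple hw⟩
end
end

section
/- Let Ḡ = (V,E) be a rooted directed graph on n vertices with a self-loop at each vertex, and let w ∈ Sp[V]. Then the set 𝔸̄_Ḡ(w) of sparse stochastic matrices Ā with pattern Ḡ, having 1 as a simple eigenvalue and satisfying Āᵀ w = w, is nonempty if and only if V_w = {i ∈ V : w_i ≠ 0} is a relevant subset of Ḡ. Equivalently, the set W̄ of all w ∈ Sp[V] for which 𝔸̄_Ḡ(w) is nonempty equals ∪_{i=1}^q Sp(V_i), where V_1,…,V_q are the relevant subsets of Ḡ. -/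
open Matrix Finset
open scoped Classical

noncomputable section

/-- `A` is a stochastic matrix: all entries are nonnegative and every row sums to one. -/
def IsStochastic {n : ℕ} (A : Matrix (Fin n) (Fin n) ℝ) : Prop :=
  (∀ i j, 0 ≤ A i j) ∧ ∀ i, ∑ j, A i j = 1

/-- `A` has the zero pattern prescribed by the digraph `E` (which may have self-loops):
`A i j = 0` whenever `i → j` is not an edge. -/
def InPatternLoops {n : ℕ} (E : Fin n → Fin n → Prop) (A : Matrix (Fin n) (Fin n) ℝ) : Prop :=
  ∀ i j, ¬ E i j → A i j = 0

/-- `1` is a simple eigenvalue of `A`: it is a root of multiplicity exactly one of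
the characteristic polynomial of `A`. -/
def SimpleOneEig {n : ℕ} (A : Matrix (Fin n) (Fin n) ℝ) : Prop :=
  Polynomial.rootMultiplicity 1 (Matrix.charpoly A) = 1

theorem transpose_mulVec_apply_eq_sum {n : ℕ} (A : Matrix (Fin n) (Fin n) ℝ) (w : Fin n → ℝ)
    (b : Fin n) : (Aᵀ *ᵥ w) b = ∑ a, w a * A a b := by
  simp only [Matrix.mulVec, dotProduct, Matrix.transpose_apply, mul_comm]

/-- If `1` is a simple eigenvalue of `A`, any two nonzero left fixed vectors are proportional. -/
theorem exists_smul_eq_of_simpleOneEig {n : ℕ} {A : Matrix (Fin n) (Fin n) ℝ}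
    (hA : SimpleOneEig A) {x y : Fin n → ℝ} (hx : Aᵀ *ᵥ x = x) (hy : Aᵀ *ᵥ y = y)
    (hx0 : x ≠ 0) : ∃ c : ℝ, c • x = y := by
  have h1 : Module.finrank ℝ (Module.End.eigenspace (Matrix.toLin' Aᵀ) (1 : ℝ)) ≤ 1 := by
    have := LinearMap.finrank_eigenspace_le (Matrix.toLin' Aᵀ) (1 : ℝ)
    rw [Matrix.charpoly_toLin', Matrix.charpoly_transpose] at this
    exact this.trans hA.le
  have hmem : ∀ z : Fin n → ℝ, Aᵀ *ᵥ z = z → z ∈ Module.End.eigenspace (Matrix.toLin' Aᵀ) (1 : ℝ) := by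
    intro z hz
    rw [Module.End.mem_eigenspace_iff, Matrix.toLin'_apply, hz, one_smul]
  obtain ⟨v, hv⟩ := finrank_le_one_iff.1 h1
  obtain ⟨a, ha⟩ := hv ⟨x, hmem x hx⟩
  obtain ⟨b, hb⟩ := hv ⟨y, hmem y hy⟩
  have ha' : a • (v : Fin n → ℝ) = x := congrArg Subtype.val ha
  have hb' : b • (v : Fin n → ℝ) = y := congrArg Subtype.val hb
  have ha0 : a ≠ 0 := by
    rintro rfl
    exact hx0 (by rw [← ha', zero_smul])
  refine ⟨b / a, ?_⟩
  rw [← ha', ← hb', smul_smul, div_mul_cancel₀ _ ha0]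

/-- A stochastic matrix has a nonzero left fixed vector supported on any nonempty closed class. -/
theorem exists_left_fixed_of_closed {n : ℕ} {A : Matrix (Fin n) (Fin n) ℝ}
    (hA : IsStochastic A) {R : Set (Fin n)} (hR : R.Nonempty)
    (hcl : ∀ i ∈ R, ∀ j ∉ R, A i j = 0) :
    ∃ x : Fin n → ℝ, x ≠ 0 ∧ Aᵀ *ᵥ x = x ∧ ∀ j ∉ R, x j = 0 := by
  let M : Matrix (Fin n) (Fin n) ℝ := fun i j =>
    if i ∈ R then (1 : Matrix (Fin n) (Fin n) ℝ) i j - A i j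
    else (1 : Matrix (Fin n) (Fin n) ℝ) i j
  have hdet : M.det = 0 := by
    rw [← Matrix.exists_mulVec_eq_zero_iff]
    refine ⟨fun j => if j ∈ R then 1 else 0, ?_, ?_⟩
    · obtain ⟨r, hr⟩ := hR
      intro h
      simpa [hr] using congrFun h r
    · funext i
      by_cases hi : i ∈ R
      · have h : ∀ j, M i j * (if j ∈ R then 1 else 0)
            = (1 : Matrix (Fin n) (Fin n) ℝ) i j - A i j := by
          intro j
          by_cases hj : j ∈ R
          · simp [M, hi, hj]
          · have hij : i ≠ j := fun h => hj (h ▸ hi)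
            simp [hj, hcl i hi j hj, Matrix.one_apply_ne hij]
        simp only [Matrix.mulVec, dotProduct, h, Finset.sum_sub_distrib, hA.2 i]
        simp [Matrix.one_apply]
      · have h : ∀ j, M i j = (1 : Matrix (Fin n) (Fin n) ℝ) i j := fun j => by simp [M, hi]
        simp only [Matrix.mulVec, dotProduct, h, Matrix.one_apply, ite_mul, one_mul, zero_mul,
          Finset.sum_ite_eq, Finset.mem_univ, if_true, hi, if_false, Pi.zero_apply]
  obtain ⟨v, hv0, hv⟩ := Matrix.exists_vecMul_eq_zero_iff.2 hdet
  have hcol : ∀ j, v j = ∑ i, if i ∈ R then v i * A i j else 0 := by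
    intro j
    have h := congrFun hv j
    have h' : ∀ i, v i * M i j = v i * (1 : Matrix (Fin n) (Fin n) ℝ) i j
        - if i ∈ R then v i * A i j else 0 := by
      intro i
      by_cases hi : i ∈ R <;> simp [M, hi, mul_sub]
    simp only [Matrix.vecMul, dotProduct, h', Finset.sum_sub_distrib] at h
    simp only [Matrix.one_apply, mul_ite, mul_one, mul_zero, Finset.sum_ite_eq',
      Finset.mem_univ, if_true, Pi.zero_apply] at h
    linarith
  have hoff : ∀ j ∉ R, v j = 0 := by
    intro j hj
    rw [hcol j]
    refine Finset.sum_eq_zero fun i _ => ?_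
    split_ifs with hi
    · rw [hcl i hi j hj, mul_zero]
    · rfl
  refine ⟨v, hv0, ?_, hoff⟩
  funext j
  rw [hcol j, transpose_mulVec_apply_eq_sum]
  refine Finset.sum_congr rfl fun i _ => ?_
  split_ifs with hi
  · rfl
  · rw [hoff i hi, zero_mul]

/-- A stochastic matrix with `1` as a simple eigenvalue has no two disjoint closed classes. -/
theorem not_disjoint_of_closed {n : ℕ} {A : Matrix (Fin n) (Fin n) ℝ}
    (hA : IsStochastic A) (hs : SimpleOneEig A) {R T : Set (Fin n)}
    (hR : R.Nonempty) (hT : T.Nonempty)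
    (hRcl : ∀ i ∈ R, ∀ j ∉ R, A i j = 0) (hTcl : ∀ i ∈ T, ∀ j ∉ T, A i j = 0) :
    ¬ Disjoint R T := by
  intro hd
  obtain ⟨x, hx0, hx, hxR⟩ := exists_left_fixed_of_closed hA hR hRcl
  obtain ⟨y, hy0, hy, hyT⟩ := exists_left_fixed_of_closed hA hT hTcl
  obtain ⟨c, rfl⟩ := exists_smul_eq_of_simpleOneEig hs hx hy hx0
  apply hy0
  funext j
  by_cases hj : j ∈ R
  · exact hyT j (Set.disjoint_left.1 hd hj)
  · simp [hxR j hj]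

/-- If `w` is a stationary vector of `A`, no mass flows into a closed class from outside it. -/
theorem stationary_no_inflow {n : ℕ} {A : Matrix (Fin n) (Fin n) ℝ}
    (hA : IsStochastic A) {w : Fin n → ℝ} (hw : ∀ i, 0 ≤ w i) (hfix : Aᵀ *ᵥ w = w)
    {R : Set (Fin n)} (hcl : ∀ i ∈ R, ∀ j ∉ R, A i j = 0)
    {k j : Fin n} (hk : k ∉ R) (hj : j ∈ R) : w k * A k j = 0 := by
  have hst : ∀ b, ∑ a, w a * A a b = w b := fun b => by
    rw [← transpose_mulVec_apply_eq_sum, hfix]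
  have hnn : ∀ a, 0 ≤ ∑ b, if b ∈ R then w a * A a b else 0 := fun a =>
    Finset.sum_nonneg fun b _ => by
      split_ifs
      · exact mul_nonneg (hw a) (hA.1 a b)
      · exact le_rfl
  have hin : ∀ a ∈ R, (∑ b, if b ∈ R then w a * A a b else 0) = w a := by
    intro a ha
    calc (∑ b, if b ∈ R then w a * A a b else 0) = ∑ b, w a * A a b := by
          refine Finset.sum_congr rfl fun b _ => ?_
          split_ifs with hb
          · rfl
          · rw [hcl a ha b hb, mul_zero]
      _ = w a := by rw [← Finset.mul_sum, hA.2 a, mul_one]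
  have htot : (∑ a, ∑ b, if b ∈ R then w a * A a b else 0) = ∑ b, if b ∈ R then w b else 0 := by
    rw [Finset.sum_comm]
    refine Finset.sum_congr rfl fun b _ => ?_
    split_ifs
    · exact hst b
    · simp
  have hzero : (∑ a, ((∑ b, if b ∈ R then w a * A a b else 0) - if a ∈ R then w a else 0)) = 0 := by
    rw [Finset.sum_sub_distrib, htot, sub_self]
  have hk0 := (Finset.sum_eq_zero_iff_of_nonneg (fun a _ => by
    by_cases ha : a ∈ R
    · simp only [hin a ha, ha, if_true, sub_self, le_refl]
    · simpa only [ha, if_false, sub_zero] using hnn a)).1 hzero k (Finset.mem_univ k)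
  simp only [hk, if_false, sub_zero] at hk0
  have := (Finset.sum_eq_zero_iff_of_nonneg (fun b _ => by
    split_ifs
    · exact mul_nonneg (hw k) (hA.1 k b)
    · exact le_rfl)).1 hk0 j (Finset.mem_univ j)
  simpa [hj] using this

/-- The support of a stationary vector of a stochastic matrix is closed. -/
theorem entry_eq_zero_of_leaves_support {n : ℕ} {A : Matrix (Fin n) (Fin n) ℝ}
    (hA : IsStochastic A) {w : Fin n → ℝ} (hw : ∀ i, 0 ≤ w i) (hfix : Aᵀ *ᵥ w = w)
    {a b : Fin n} (ha : w a ≠ 0) (hb : w b = 0) : A a b = 0 := by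
  have hsum : ∑ c, w c * A c b = 0 := by rw [← transpose_mulVec_apply_eq_sum, hfix, hb]
  have := (Finset.sum_eq_zero_iff_of_nonneg
    (fun c _ => mul_nonneg (hw c) (hA.1 c b))).1 hsum a (Finset.mem_univ a)
  exact (mul_eq_zero.1 this).resolve_left ha

/-- If `1` is a simple eigenvalue of a stochastic matrix, every vertex reaches every vertex of the
support of the stationary vector along positive entries. -/
theorem reaches_support {n : ℕ} {A : Matrix (Fin n) (Fin n) ℝ}
    (hA : IsStochastic A) (hs : SimpleOneEig A) {w : Fin n → ℝ} (hw : ∀ i, 0 ≤ w i)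
    (hfix : Aᵀ *ᵥ w = w) (v : Fin n) {i : Fin n} (hi : w i ≠ 0) :
    Relation.ReflTransGen (fun a b => A a b ≠ 0) v i := by
  by_contra hvi
  let R : Set (Fin n) := {u | Relation.ReflTransGen (fun a b => A a b ≠ 0) v u}
  have hRcl : ∀ a ∈ R, ∀ b ∉ R, A a b = 0 := by
    intro a ha b hb
    by_contra hab
    exact hb (Relation.ReflTransGen.tail ha hab)
  refine not_disjoint_of_closed hA hs (R := R) (T := {a | w a ≠ 0 ∧ a ∉ R})
    ⟨v, Relation.ReflTransGen.refl⟩ ⟨i, hi, hvi⟩ hRcl ?_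
    (Set.disjoint_left.2 fun a ha ha' => ha'.2 ha)
  rintro a ⟨ha, haR⟩ b hb
  by_cases hbR : b ∈ R
  · exact (mul_eq_zero.1 (stationary_no_inflow hA hw hfix hRcl haR hbR)).resolve_left ha
  · have hwb : w b = 0 := by
      by_contra h
      exact hb ⟨h, hbR⟩
    exact entry_eq_zero_of_leaves_support hA hw hfix ha hwb

/-- A harmonic function of a stochastic matrix is maximal at any vertex reachable from everywhere. -/
theorem le_of_harmonic {n : ℕ} {A : Matrix (Fin n) (Fin n) ℝ} (hA : IsStochastic A)
    {s : Fin n} (hs : ∀ v, Relation.ReflTransGen (fun a b => A a b ≠ 0) v s)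
    {x : Fin n → ℝ} (hx : A *ᵥ x = x) (v : Fin n) : x v ≤ x s := by
  obtain ⟨m, -, hm⟩ := Finset.exists_max_image Finset.univ x ⟨s, Finset.mem_univ s⟩
  have key : ∀ u, Relation.ReflTransGen (fun a b => A a b ≠ 0) m u → x u = x m := by
    intro u hu
    induction hu with
    | refl => rfl
    | @tail b c _ hbc ih =>
      have hsum : ∑ j, A b j * (x m - x j) = 0 := by
        have h : ∑ j, A b j * x j = x b := congrFun hx b
        simp only [mul_sub, Finset.sum_sub_distrib, ← Finset.sum_mul, hA.2 b, h, ih, one_mul,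
          sub_self]
      have := (Finset.sum_eq_zero_iff_of_nonneg (fun j _ =>
        mul_nonneg (hA.1 b j) (sub_nonneg.2 (hm j (Finset.mem_univ j))))).1 hsum c
          (Finset.mem_univ c)
      linarith [(mul_eq_zero.1 this).resolve_left hbc]
  rw [key s (hs m)]
  exact hm v (Finset.mem_univ v)

/-- A stochastic matrix with a stationary probability vector and a vertex reachable from everywhere
has `1` as a simple eigenvalue. -/
theorem simpleOneEig_of_reachable {n : ℕ} {A : Matrix (Fin n) (Fin n) ℝ} (hA : IsStochastic A)
    {s : Fin n} (hs : ∀ v, Relation.ReflTransGen (fun a b => A a b ≠ 0) v s)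
    {w : Fin n → ℝ} (hw : ∑ i, w i = 1) (hfix : Aᵀ *ᵥ w = w) : SimpleOneEig A := by
  have hconst : ∀ x : Fin n → ℝ, A *ᵥ x = x → ∀ v, x v = x s := by
    intro x hx v
    refine le_antisymm (le_of_harmonic hA hs hx v) ?_
    have := le_of_harmonic hA hs (x := -x) (by rw [Matrix.mulVec_neg, hx]) v
    simpa using this
  have hpow : ∀ k : ℕ, ∀ x : Fin n → ℝ,
      ((Matrix.toLin' A - (1 : ℝ) • (1 : Module.End ℝ (Fin n → ℝ))) ^ k) x = 0 →
        ∀ v, x v = x s := by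
    intro k
    induction k with
    | zero =>
      intro x hx v
      have hx0 : x = 0 := by simpa using hx
      simp [hx0]
    | succ k ih =>
      intro x hx
      rw [pow_succ, Module.End.mul_apply] at hx
      have hy := ih _ hx
      simp only [LinearMap.sub_apply, Matrix.toLin'_apply, one_smul, Module.End.one_apply] at hy
      have horth : w ⬝ᵥ (A *ᵥ x - x) = 0 := by
        rw [dotProduct_sub, Matrix.dotProduct_mulVec, ← Matrix.mulVec_transpose, hfix, sub_self]
      have hval : w ⬝ᵥ (A *ᵥ x - x) = (A *ᵥ x - x) s := by
        simp only [dotProduct, hy]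
        rw [← Finset.sum_mul, hw, one_mul]
      refine hconst x (sub_eq_zero.1 ?_)
      funext v
      rw [hy v, ← hval, horth, Pi.zero_apply]
  have hone : ((1 : Fin n → ℝ)) ∈ Module.End.maxGenEigenspace (Matrix.toLin' A) (1 : ℝ) := by
    rw [Module.End.mem_maxGenEigenspace]
    refine ⟨1, ?_⟩
    funext i
    simp [Matrix.mulVec, dotProduct, hA.2 i]
  have hfin : Module.finrank ℝ (Module.End.maxGenEigenspace (Matrix.toLin' A) (1 : ℝ)) = 1 := by
    refine (finrank_eq_one_iff_of_nonzero' ⟨1, hone⟩ ?_).2 ?_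
    · intro h
      simpa using congrFun (congrArg Subtype.val h) s
    · rintro ⟨x, hx⟩
      obtain ⟨k, hk⟩ := (Module.End.mem_maxGenEigenspace _ _ _).1 hx
      refine ⟨x s, Subtype.ext ?_⟩
      funext v
      simp [hpow k x hk v]
  rw [LinearMap.finrank_maxGenEigenspace_eq, Matrix.charpoly_toLin'] at hfin
  exact hfin

/-- A directed path from `i` to `j` carries a unit flow from `i` to `j`. -/
theorem exists_unit_flow {n : ℕ} {r : Fin n → Fin n → Prop} {i j : Fin n}
    (h : Relation.ReflTransGen r i j) :
    ∃ F : Matrix (Fin n) (Fin n) ℝ, (∀ a b, 0 ≤ F a b) ∧ (∀ a b, ¬ r a b → F a b = 0) ∧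
      ∀ k, ∑ b, F k b - ∑ a, F a k = (if k = i then 1 else 0) - if k = j then 1 else 0 := by
  induction h with
  | refl => exact ⟨0, by simp, by simp, by simp⟩
  | @tail b c _ hbc ih =>
    obtain ⟨F, h0, hr, hF⟩ := ih
    refine ⟨fun x y => F x y + if x = b ∧ y = c then 1 else 0, ?_, ?_, ?_⟩
    · intro x y
      have := h0 x y
      positivity
    · intro x y hxy
      have : ¬ (x = b ∧ y = c) := by
        rintro ⟨rfl, rfl⟩
        exact hxy hbc
      simp [hr x y hxy, this]
    · intro k
      have h1 := hF k
      have h2 : (∑ y, if k = b ∧ y = c then (1 : ℝ) else 0) = if k = b then 1 else 0 := by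
        by_cases hk : k = b <;> simp [hk]
      have h3 : (∑ x, if x = b ∧ k = c then (1 : ℝ) else 0) = if k = c then 1 else 0 := by
        by_cases hk : k = c <;> simp [hk]
      simp only [Finset.sum_add_distrib, h2, h3]
      linarith

/-- A relation all of whose edges lie on directed cycles carries a circulation that is positive
exactly on its edges. -/
theorem exists_circulation {n : ℕ} {r : Fin n → Fin n → Prop}
    (h : ∀ a b, r a b → Relation.ReflTransGen r b a) :
    ∃ F : Matrix (Fin n) (Fin n) ℝ, (∀ a b, 0 ≤ F a b) ∧ (∀ a b, F a b ≠ 0 ↔ r a b) ∧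
      ∀ k, ∑ b, F k b = ∑ a, F a k := by
  have hcycle : ∀ p : Fin n × Fin n, ∃ F : Matrix (Fin n) (Fin n) ℝ, (∀ a b, 0 ≤ F a b) ∧
      (∀ a b, ¬ r a b → F a b = 0) ∧ (∀ k, ∑ b, F k b = ∑ a, F a k) ∧
      (r p.1 p.2 → 0 < F p.1 p.2) := by
    rintro ⟨a, b⟩
    by_cases hab : r a b
    · obtain ⟨G, g0, gr, hG⟩ := exists_unit_flow (h a b hab)
      refine ⟨fun x y => G x y + if x = a ∧ y = b then 1 else 0, ?_, ?_, ?_, ?_⟩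
      · intro x y
        have := g0 x y
        positivity
      · intro x y hxy
        have : ¬ (x = a ∧ y = b) := by
          rintro ⟨rfl, rfl⟩
          exact hxy hab
        simp [gr x y hxy, this]
      · intro k
        have h1 := hG k
        have h2 : (∑ y, if k = a ∧ y = b then (1 : ℝ) else 0) = if k = a then 1 else 0 := by
          by_cases hk : k = a <;> simp [hk]
        have h3 : (∑ x, if x = a ∧ k = b then (1 : ℝ) else 0) = if k = b then 1 else 0 := by
          by_cases hk : k = b <;> simp [hk]
        simp only [Finset.sum_add_distrib, h2, h3]
        linarith
      · intro _
        have := g0 a b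
        simp only [and_self, if_true]
        linarith
    · exact ⟨0, by simp, by simp, by simp, fun h => absurd h hab⟩
  choose F h0 hr hbal hpos using hcycle
  refine ⟨fun a b => ∑ p, F p a b, fun a b => Finset.sum_nonneg fun p _ => h0 p a b, ?_, ?_⟩
  · intro a b
    refine ⟨fun hne => ?_, fun hab => ?_⟩
    · by_contra hab
      exact hne (Finset.sum_eq_zero fun p _ => hr p a b hab)
    · exact ne_of_gt (Finset.sum_pos' (fun p _ => h0 p a b)
        ⟨(a, b), Finset.mem_univ _, hpos (a, b) hab⟩)
  · intro k
    calc ∑ b, ∑ p, F p k b = ∑ p, ∑ b, F p k b := Finset.sum_comm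
      _ = ∑ p, ∑ a, F p a k := Finset.sum_congr rfl fun p _ => hbal p k
      _ = ∑ a, ∑ p, F p a k := Finset.sum_comm

/-- For a weight `w` whose support is strongly connected in a digraph with loops, there is a
stochastic matrix with the pattern of the digraph fixing `w`, positive on every non-loop edge
except those leaving the support. -/
theorem exists_stochastic_of_stronglyConnected {n : ℕ} {E : Fin n → Fin n → Prop}
    (hloops : ∀ i, E i i) {w : Fin n → ℝ} (hw : ∀ i, 0 ≤ w i)
    (hsc : ∀ i, w i ≠ 0 → ∀ j, w j ≠ 0 →
      Relation.ReflTransGen (fun a b => E a b ∧ w a ≠ 0 ∧ w b ≠ 0) i j) :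
    ∃ A : Matrix (Fin n) (Fin n) ℝ, IsStochastic A ∧ InPatternLoops E A ∧ Aᵀ *ᵥ w = w ∧
      ∀ a b, a ≠ b → E a b → (w a ≠ 0 → w b ≠ 0) → A a b ≠ 0 := by
  obtain ⟨F, hF0, hF, hbal⟩ := exists_circulation
    (r := fun a b => E a b ∧ w a ≠ 0 ∧ w b ≠ 0) fun a b h => hsc b h.2.2 a h.2.1
  have hr0 : ∀ a, 0 ≤ ∑ b, F a b := fun a => Finset.sum_nonneg fun b _ => hF0 a b
  have hFw : ∀ a b, w a = 0 → F a b = 0 := by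
    intro a b ha
    by_contra h
    exact ((hF a b).1 h).2.1 ha
  obtain ⟨C, hC, hCw⟩ : ∃ C : ℝ, 0 < C ∧ ∀ a, w a ≠ 0 → (∑ b, F a b) / (C * w a) ≤ 1 := by
    have hnn : ∀ a, 0 ≤ (∑ b, F a b) / w a := fun a => div_nonneg (hr0 a) (hw a)
    have hC : 0 < ∑ a, (∑ b, F a b) / w a + 1 := by
      have := Finset.sum_nonneg fun a (_ : a ∈ Finset.univ) => hnn a
      linarith
    refine ⟨_, hC, fun a ha => ?_⟩
    have ha' : 0 < w a := lt_of_le_of_ne (hw a) ha.symm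
    rw [div_le_one (mul_pos hC ha'), ← div_le_iff₀ ha']
    have := Finset.single_le_sum (fun a _ => hnn a) (Finset.mem_univ a)
    linarith
  have hd : ∀ a, 0 < ∑ b, if E a b then (1 : ℝ) else 0 := fun a =>
    Finset.sum_pos' (fun b _ => by split_ifs <;> norm_num)
      ⟨a, Finset.mem_univ a, by simp [hloops a]⟩
  let A : Matrix (Fin n) (Fin n) ℝ := fun a b =>
    if w a = 0 then (if E a b then 1 else 0) / ∑ c, if E a c then (1 : ℝ) else 0
    else F a b / (C * w a) + if a = b then 1 - (∑ c, F a c) / (C * w a) else 0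
  refine ⟨A, ⟨?_, ?_⟩, ?_, ?_, ?_⟩
  · intro a b
    by_cases ha : w a = 0
    · simp only [A, ha, if_true]
      exact div_nonneg (by split_ifs <;> norm_num) (hd a).le
    · simp only [A, ha, if_false]
      refine add_nonneg (div_nonneg (hF0 a b) (mul_nonneg hC.le (hw a))) ?_
      split_ifs
      · linarith [hCw a ha]
      · exact le_rfl
  · intro a
    by_cases ha : w a = 0
    · simp only [A, ha, if_true]
      rw [← Finset.sum_div, div_self (hd a).ne']
    · simp only [A, ha, if_false, Finset.sum_add_distrib, ← Finset.sum_div, Finset.sum_ite_eq,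
        Finset.mem_univ, if_true]
      ring
  · intro a b hab
    have hne : a ≠ b := fun h => hab (h ▸ hloops a)
    have hFab : F a b = 0 := by
      by_contra h
      exact hab ((hF a b).1 h).1
    simp [A, hab, hne, hFab]
  · have hterm : ∀ a b, w a * A a b = F a b / C + if a = b then w a - (∑ c, F a c) / C else 0 := by
      intro a b
      by_cases ha : w a = 0
      · simp [ha, hFw a _ ha]
      · simp only [A, ha, if_false]
        split_ifs
        · field_simp
        · field_simp
          ring
    funext b
    calc (Aᵀ *ᵥ w) b = ∑ a, w a * A a b := transpose_mulVec_apply_eq_sum A w b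
      _ = w b := by
          simp only [hterm, Finset.sum_add_distrib, ← Finset.sum_div, Finset.sum_ite_eq',
            Finset.mem_univ, if_true, hbal b]
          ring
  · intro a b hab hE hwab
    by_cases ha : w a = 0
    · simp only [A, ha, hE, if_true]
      exact (div_pos one_pos (hd a)).ne'
    · simp only [A, ha, hab, if_false, add_zero]
      exact div_ne_zero ((hF a b).2 ⟨hE, ha, hwab ha⟩) (mul_ne_zero hC.ne' ha)

/-- Theorem 2: for a rooted digraph `Ḡ` with a self-loop at each vertex, the set
`𝔸̄_Ḡ(w)` of sparse stochastic matrices with `1` a simple eigenvalue and `Āᵀ w = w`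
is nonempty iff the support of `w` is a relevant subset of `Ḡ`. -/
theorem stochastic_feasible_nonempty_iff_support_relevant
    (n : ℕ) (hn : 1 ≤ n) (E : Fin n → Fin n → Prop) (hloops : ∀ i, E i i)
    (hrooted : Rooted E) (w : Fin n → ℝ) (hw : MemSimplex w) :
    (∃ A : Matrix (Fin n) (Fin n) ℝ,
        IsStochastic A ∧ InPatternLoops E A ∧ SimpleOneEig A ∧ Aᵀ *ᵥ w = w) ↔
      RelevantSubset E {i | w i ≠ 0} := by
  constructor
  · rintro ⟨A, hA, hpat, hs, hfix⟩
    have hedge : ∀ a b, A a b ≠ 0 → E a b := fun a b h => by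
      by_contra hE
      exact h (hpat a b hE)
    have hreach := fun v i (hi : w i ≠ 0) => reaches_support hA hs hw.1 hfix v hi
    refine ⟨fun i hi v => Relation.ReflTransGen.mono hedge v i (hreach v i hi), fun i hi j hj => ?_⟩
    have hclosed : ∀ a b, w a ≠ 0 → A a b ≠ 0 → w b ≠ 0 := by
      intro a b ha hab hb
      exact hab (entry_eq_zero_of_leaves_support hA hw.1 hfix ha hb)
    suffices ∀ u, Relation.ReflTransGen (fun a b => A a b ≠ 0) i u → w u ≠ 0 ∧
        Relation.ReflTransGen (fun a b => E a b ∧ a ∈ {i | w i ≠ 0} ∧ b ∈ {i | w i ≠ 0}) i u from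
      (this j (hreach i j hj)).2
    intro u hu
    induction hu with
    | refl => exact ⟨hi, Relation.ReflTransGen.refl⟩
    | @tail b c _ hbc ih =>
      have hc := hclosed b c ih.1 hbc
      exact ⟨hc, ih.2.tail ⟨hedge b c hbc, ih.1, hc⟩⟩
  · rintro ⟨hroot, hsc⟩
    obtain ⟨s, hs⟩ : ∃ s, w s ≠ 0 := by
      by_contra! h
      simpa [h] using hw.2
    obtain ⟨A, hA, hpat, hfix, hpos⟩ := exists_stochastic_of_stronglyConnected hloops hw.1 hsc
    have hstep : ∀ a b, E a b → (w a ≠ 0 → w b ≠ 0) →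
        Relation.ReflTransGen (fun a b => A a b ≠ 0) a b := by
      intro a b hE hab
      by_cases h : a = b
      · exact h ▸ Relation.ReflTransGen.refl
      · exact Relation.ReflTransGen.single (hpos a b h hE hab)
    refine ⟨A, hA, hpat, simpleOneEig_of_reachable hA (s := s) (fun v => ?_) hw.2 hfix, hfix⟩
    induction hroot s hs v using Relation.ReflTransGen.head_induction_on with
    | refl => exact Relation.ReflTransGen.refl
    | @head a b hab _ ih =>
      by_cases ha : w a = 0
      · exact (hstep a b hab fun h => absurd ha h).trans ih
      · have hpath := hsc a ha s hs
        exact Relation.reflTransGen_closed (fun c d h => hstep c d h.1 fun _ => h.2.2) a s hpath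
end
end

section
/- Let G = (V,E) be a rooted simple directed graph and let w ∈ Sp[V]. If 𝔸_G(w) is nonempty, then V_w = {i ∈ V : w_i ≠ 0} is a relevant subset of G. -/
open Matrix Finset
open scoped Classical

noncomputable section

/-- A sum over a set equals the full sum if the summand vanishes off the set. -/
theorem sum_subtype_eq_sum {n : ℕ} {B : Set (Fin n)} {f : Fin n → ℝ} (hf : ∀ i ∉ B, f i = 0) :
    ∑ i : B, f i = ∑ i, f i := by
  rw [← Finset.sum_filter_of_ne (p := (· ∈ B)) fun i _ hi => not_not.mp fun h => hi (hf i h)]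
  exact (Finset.sum_subtype _ (by simp) f).symm

namespace SimpleZeroEig

/-- If `0` is a simple eigenvalue, then a left null vector that vanishes somewhere on the
support of another left null vector is zero. -/
theorem eq_zero_of_apply_eq_zero {n : ℕ} {A : Matrix (Fin n) (Fin n) ℝ} (hA : SimpleZeroEig A)
    {u w : Fin n → ℝ} (hu : Aᵀ *ᵥ u = 0) (hw : Aᵀ *ᵥ w = 0) {j : Fin n} (hwj : w j ≠ 0)
    (huj : u j = 0) : u = 0 := by
  have hle : Module.finrank ℝ (Module.End.eigenspace (Matrix.toLin' Aᵀ) 0) ≤ 1 := by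
    refine (LinearMap.finrank_eigenspace_le _ _).trans ?_
    rw [Matrix.charpoly_toLin', Matrix.charpoly_transpose]
    exact le_of_eq hA
  obtain ⟨v, hv⟩ := finrank_le_one_iff.mp hle
  have span : ∀ x : Fin n → ℝ, Aᵀ *ᵥ x = 0 → ∃ c : ℝ, c • (v : Fin n → ℝ) = x := by
    intro x hx
    obtain ⟨c, hc⟩ := hv ⟨x, by simp [hx]⟩
    exact ⟨c, congrArg Subtype.val hc⟩
  obtain ⟨a, rfl⟩ := span w hw
  obtain ⟨b, rfl⟩ := span u hu
  simp only [Pi.smul_apply, smul_eq_mul, mul_eq_zero, not_or, ne_eq] at hwj huj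
  rw [huj.resolve_right hwj.2, zero_smul]

end SimpleZeroEig

namespace IsISM

variable {n : ℕ} {A : Matrix (Fin n) (Fin n) ℝ}

/-- A nonempty set of vertices without outgoing transitions carries a left null vector. -/
theorem exists_left_null_of_closed_s2 (hA : IsISM A) {B : Set (Fin n)} (hB : B.Nonempty)
    (hclosed : ∀ a ∈ B, ∀ b ∉ B, A a b = 0) :
    ∃ u : Fin n → ℝ, u ≠ 0 ∧ (∀ i ∉ B, u i = 0) ∧ Aᵀ *ᵥ u = 0 := by
  let M : Matrix B B ℝ := A.submatrix (↑) (↑)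
  have hdet : M.det = 0 := by
    rw [← Matrix.exists_mulVec_eq_zero_iff]
    refine ⟨1, fun h => ?_, funext fun i => ?_⟩
    · simpa using congrFun h ⟨_, hB.some_mem⟩
    · have hsum : ∑ k : B, A i k = ∑ k, A i k := by
        exact sum_subtype_eq_sum fun k hk => hclosed i i.2 k hk
      simp [M, Matrix.mulVec, dotProduct, hsum, hA.2]
  obtain ⟨v, hv, hvM⟩ := Matrix.exists_vecMul_eq_zero_iff.mpr hdet
  let u : Fin n → ℝ := fun i => if h : i ∈ B then v ⟨i, h⟩ else 0
  have hu : ∀ i ∉ B, u i = 0 := fun i hi => dif_neg hi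
  refine ⟨u, fun h => hv (funext fun i => ?_), hu, funext fun k => ?_⟩
  · simpa [u] using congrFun h i
  · change ∑ i, A i k * u i = 0
    by_cases hk : k ∈ B
    · have h := congrFun hvM ⟨k, hk⟩
      change ∑ i : B, v i * A i k = 0 at h
      rw [← h, ← sum_subtype_eq_sum (B := B) fun i hi => by rw [hu i hi, mul_zero]]
      exact Finset.sum_congr rfl fun i _ => by simp [u, mul_comm]
    · refine Finset.sum_eq_zero fun i _ => ?_
      by_cases hi : i ∈ B
      · rw [hclosed i hi k hk, zero_mul]
      · rw [hu i hi, mul_zero]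

/-- The support of a nonnegative left null vector has no outgoing transitions. -/
theorem ne_zero_of_pos (hA : IsISM A) {w : Fin n → ℝ} (hw : ∀ i, 0 ≤ w i)
    (hAw : Aᵀ *ᵥ w = 0) {a b : Fin n} (hab : 0 < A a b) (ha : w a ≠ 0) : w b ≠ 0 := by
  intro hb
  have hsum : ∑ i, A i b * w i = 0 := congrFun hAw b
  have hnonneg : ∀ i ∈ Finset.univ, 0 ≤ A i b * w i := fun i _ => by
    rcases eq_or_ne i b with rfl | hi
    · simp [hb]
    · exact mul_nonneg (hA.1 i b hi) (hw i)
  exact mul_ne_zero hab.ne' ha ((Finset.sum_eq_zero_iff_of_nonneg hnonneg).mp hsum a (by simp))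

/-- If `0` is a simple eigenvalue, then every vertex reaches every vertex of the support of a
left null vector along positive transitions. -/
theorem reflTransGen_of_simpleZeroEig (hA : IsISM A) (hs : SimpleZeroEig A) {w : Fin n → ℝ}
    (hAw : Aᵀ *ᵥ w = 0) {j : Fin n} (hj : w j ≠ 0) (i : Fin n) :
    Relation.ReflTransGen (fun a b => a ≠ b ∧ 0 < A a b) i j := by
  by_contra hij
  obtain ⟨u, hu, huB, hAu⟩ := hA.exists_left_null_of_closed_s2
    (B := {i | ¬ Relation.ReflTransGen (fun a b => a ≠ b ∧ 0 < A a b) i j}) ⟨i, hij⟩ (by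
      intro a ha b hb
      have hne : a ≠ b := fun h => hb (h ▸ ha)
      refine le_antisymm (not_lt.mp fun hpos => ha ?_) (hA.1 a b hne)
      exact .head ⟨hne, hpos⟩ (not_not.mp hb))
  exact hu (hs.eq_zero_of_apply_eq_zero hAu hAw hj (huB j fun h => h .refl))

end IsISM

/-- Proposition 1: if `𝔸_G(w)` is nonempty, then the support `V_w` of `w` is a
relevant subset of the rooted digraph `G`. -/
theorem support_relevant_of_feasible_nonempty
    (n : ℕ) (hn : 1 ≤ n) (E : Fin n → Fin n → Prop) (hsimple : ∀ i, ¬ E i i)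
    (hrooted : Rooted E) (w : Fin n → ℝ) (hw : MemSimplex w)
    (hne : ∃ A, Feasible E w A) :
    RelevantSubset E {i | w i ≠ 0} := by
  obtain ⟨A, hA, hpat, hs, hAw⟩ := hne
  have edge : ∀ a b, a ≠ b ∧ 0 < A a b → E a b := fun a b h =>
    not_not.mp fun hE => h.2.ne' (hpat a b h.1 hE)
  refine ⟨fun j hj i => Relation.ReflTransGen.mono edge i j
      (hA.reflTransGen_of_simpleZeroEig hs hAw hj i),
    fun i hi j hj => ?_⟩
  induction hA.reflTransGen_of_simpleZeroEig hs hAw hj i using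
    Relation.ReflTransGen.head_induction_on with
  | refl => exact .refl
  | head hab _ ih =>
    have hb := hA.ne_zero_of_pos hw.1 hAw hab.2 hi
    exact .head ⟨edge _ _ hab, hi, hb⟩ (ih hb)
end
end

section
/- Let G = (V,E) be a rooted simple directed graph and let w ∈ Sp[V]. If 𝔸_G(w) is nonempty, then the subgraph G_w of G induced by V_w = {i ∈ V : w_i ≠ 0} is strongly connected: for any ordered pair (i,j) of vertices of V_w there is a directed path in G from i to j all of whose vertices lie in V_w. -/
open Matrix Finset
open scoped Classical

noncomputable section

/-- The kernel of a matrix with `0` as a simple eigenvalue is at most a line, and so is the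
kernel of its transpose. -/
lemma SimpleZeroEig.exists_smul_eq_of_transpose_mulVec_eq_zero {n : ℕ}
    {A : Matrix (Fin n) (Fin n) ℝ} (hA : SimpleZeroEig A) {w u : Fin n → ℝ} (hw0 : w ≠ 0)
    (hw : Aᵀ *ᵥ w = 0) (hu : Aᵀ *ᵥ u = 0) : ∃ c : ℝ, u = c • w := by
  have hle := LinearMap.finrank_eigenspace_le (Matrix.mulVecLin Aᵀ) 0
  rw [Matrix.charpoly_mulVecLin, Matrix.charpoly_transpose, hA, finrank_le_one_iff] at hle
  obtain ⟨v, hv⟩ := hle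
  obtain ⟨c, hc⟩ := hv ⟨w, by rw [Module.End.mem_eigenspace_iff, zero_smul]; exact hw⟩
  obtain ⟨d, hd⟩ := hv ⟨u, by rw [Module.End.mem_eigenspace_iff, zero_smul]; exact hu⟩
  replace hc : c • (v : Fin n → ℝ) = w := congrArg Subtype.val hc
  replace hd : d • (v : Fin n → ℝ) = u := congrArg Subtype.val hd
  have hc0 : c ≠ 0 := by
    rintro rfl
    exact hw0 (by rw [← hc, zero_smul])
  refine ⟨d / c, ?_⟩
  rw [← hc, ← hd, smul_smul, div_mul_cancel₀ d hc0]

/-- No rate of an ISM `A` leaves the support of a nonnegative stationary vector `w`: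
`A a b = 0` as soon as `w a ≠ 0` and `w b = 0`. -/
lemma IsISM.eq_zero_of_stationary {n : ℕ} {A : Matrix (Fin n) (Fin n) ℝ} (hA : IsISM A)
    {w : Fin n → ℝ} (hw : ∀ i, 0 ≤ w i) (hAw : Aᵀ *ᵥ w = 0) {a b : Fin n}
    (ha : w a ≠ 0) (hb : w b = 0) : A a b = 0 := by
  have hsum : ∑ x, A x b * w x = 0 := congrFun hAw b
  have hnonneg : ∀ x ∈ Finset.univ, 0 ≤ A x b * w x := by
    intro x _
    by_cases hxb : x = b
    · simp [hxb, hb]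
    · exact mul_nonneg (hA.1 x b hxb) (hw x)
  have := (Finset.sum_eq_zero_iff_of_nonneg hnonneg).1 hsum a (Finset.mem_univ a)
  exact (mul_eq_zero.1 this).resolve_right ha

/-- The restriction of a nonnegative stationary vector `w` of an ISM `A` to a set `R` which no
rate of `A` leaves is again stationary. -/
lemma IsISM.stationary_indicator {n : ℕ} {A : Matrix (Fin n) (Fin n) ℝ} (hA : IsISM A)
    {w : Fin n → ℝ} (hw : ∀ i, 0 ≤ w i) (hAw : Aᵀ *ᵥ w = 0) {R : Set (Fin n)}
    (hR : ∀ a ∈ R, ∀ b ∉ R, A a b = 0) : Aᵀ *ᵥ R.indicator w = 0 := by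
  have hle : ∀ b ∈ Finset.univ, (Aᵀ *ᵥ R.indicator w) b ≤ 0 := by
    intro b _
    change ∑ x, A x b * R.indicator w x ≤ 0
    by_cases hb : b ∈ R
    · have hsum : ∑ x, A x b * w x = 0 := congrFun hAw b
      rw [← hsum]
      refine Finset.sum_le_sum fun x _ => ?_
      by_cases hx : x ∈ R
      · simp [hx]
      · have hxb : x ≠ b := fun h => hx (h ▸ hb)
        simpa [hx] using mul_nonneg (hA.1 x b hxb) (hw x)
    · refine (Finset.sum_eq_zero fun x _ => ?_).le
      by_cases hx : x ∈ R
      · simp [hR x hx b hb]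
      · simp [hx]
  have htotal : ∑ b, (Aᵀ *ᵥ R.indicator w) b = 0 := by
    change ∑ b, ∑ x, A x b * R.indicator w x = 0
    rw [Finset.sum_comm]
    simp [← Finset.sum_mul, hA.2]
  funext b
  exact (Finset.sum_eq_zero_iff_of_nonpos hle).1 htotal b (Finset.mem_univ b)

/-- Lemma 2: if `𝔸_G(w)` is nonempty, then the subgraph of `G` induced by the
support of `w` is strongly connected: any two support vertices are joined by a
directed path all of whose vertices lie in the support. -/
theorem support_subgraph_strongly_connected_of_feasible_nonempty
    (n : ℕ) (hn : 1 ≤ n) (E : Fin n → Fin n → Prop) (hsimple : ∀ i, ¬ E i i)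
    (hrooted : Rooted E) (w : Fin n → ℝ) (hw : MemSimplex w)
    (hne : ∃ A, Feasible E w A) :
    ∀ i, w i ≠ 0 → ∀ j, w j ≠ 0 →
      Relation.ReflTransGen (fun a b => E a b ∧ w a ≠ 0 ∧ w b ≠ 0) i j := by
  obtain ⟨A, hA, hpat, hsimp, hAw⟩ := hne
  intro i hi j hj
  set R : Set (Fin n) :=
    {x | Relation.ReflTransGen (fun a b => E a b ∧ w a ≠ 0 ∧ w b ≠ 0) i x}
  have hsupp : ∀ a ∈ R, w a ≠ 0 := by
    intro a ha
    obtain rfl | ⟨_, _, h⟩ := Relation.ReflTransGen.cases_tail ha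
    · exact hi
    · exact h.2.2
  have hclosed : ∀ a ∈ R, ∀ b ∉ R, A a b = 0 := by
    intro a ha b hb
    by_cases hwb : w b = 0
    · exact hA.eq_zero_of_stationary hw.1 hAw (hsupp a ha) hwb
    · refine hpat a b (fun h => hb (h ▸ ha)) fun hE => hb ?_
      exact Relation.ReflTransGen.tail ha ⟨hE, hsupp a ha, hwb⟩
  obtain ⟨c, hc⟩ := hsimp.exists_smul_eq_of_transpose_mulVec_eq_zero
    (fun h => hi (congrFun h i)) hAw (hA.stationary_indicator hw.1 hAw hclosed)
  have hiR : i ∈ R := Relation.ReflTransGen.refl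
  have hc1 : w i = c * w i := by simpa [hiR] using congrFun hc i
  have hc0 : c ≠ 0 := by
    rintro rfl
    exact hi (by simpa using hc1)
  by_contra hjR
  have hjR' : j ∉ R := hjR
  have hcj : 0 = c * w j := by
    simpa only [Set.indicator_of_notMem hjR', Pi.smul_apply, smul_eq_mul] using congrFun hc j
  exact mul_ne_zero hc0 hj hcj.symm
end
end

section
/- Let G be the directed n-cycle on vertices {1,…,n} (n ≥ 2), with edge set {i → i+1 : 1 ≤ i ≤ n−1} ∪ {n → 1}, and let w ∈ Sp[V]. If 𝔸_G(w) is nonempty, then either w = e_i for some standard basis vector e_i, or every entry of w is nonzero. -/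
open Matrix Finset
open scoped Classical

noncomputable section

/-- If two distinct rows of a matrix vanish, then `X ^ 2` divides its characteristic polynomial. -/
theorem X_sq_dvd_charpoly_of_rows_eq_zero {n R : Type*} [Fintype n] [DecidableEq n] [CommRing R]
    (A : Matrix n n R) {i j : n} (hij : i ≠ j) (hi : ∀ k, A i k = 0) (hj : ∀ k, A j k = 0) :
    (Polynomial.X : Polynomial R) ^ 2 ∣ A.charpoly := by
  have row {l : n} (hl : ∀ k, A l k = 0) :
      A.charmatrix l = (Polynomial.X : Polynomial R) • Pi.single l 1 := by
    ext1 k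
    rcases eq_or_ne k l with rfl | h
    · simp [hl]
    · simp [Matrix.charmatrix_apply, hl, h, Matrix.diagonal_apply_ne' _ h]
  have hM : A.charmatrix = (A.charmatrix.updateRow i
      ((Polynomial.X : Polynomial R) • Pi.single i 1)).updateRow j
        ((Polynomial.X : Polynomial R) • Pi.single j 1) := by
    rw [← row hi, ← row hj, Matrix.updateRow_eq_self, Matrix.updateRow_eq_self]
  rw [Matrix.charpoly, hM, Matrix.det_updateRow_smul, Matrix.updateRow_comm _ hij,
    Matrix.det_updateRow_smul, ← mul_assoc, ← sq]
  exact dvd_mul_right _ _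

/-- A function on `Fin n` invariant under the cyclic shift is constant. -/
theorem Fin.apply_eq_of_apply_add_one_eq {n : ℕ} [NeZero n] {α : Type*} {f : Fin n → α}
    (h : ∀ i, f (i + 1) = f i) (i k : Fin n) : f i = f k := by
  have hm (m : ℕ) : f (k + Fin.ofNat n m) = f k := by
    induction m with
    | zero => simp
    | succ m ih =>
      rw [← ih, ← h (k + Fin.ofNat n m)]
      congr 1
      apply Fin.ext
      simp [Fin.val_add, add_assoc]
  simpa using hm (i - k).val

/-- Corollary 1: for the directed `n`-cycle (`n ≥ 2`), if `𝔸_G(w)` is nonempty then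
either `w` is a standard basis vector or every entry of `w` is nonzero. -/
theorem cycle_graph_feasible_weights
    (n : ℕ) [NeZero n] (hn : 2 ≤ n) (w : Fin n → ℝ) (hw : MemSimplex w)
    (hne : ∃ A, Feasible (fun i j : Fin n => j = i + 1) w A) :
    (∃ i, w = Pi.single i 1) ∨ ∀ i, w i ≠ 0 := by
  obtain ⟨A, ⟨-, hsum⟩, hpat, hsimple, hker⟩ := hne
  have : Nontrivial (Fin n) := Fin.nontrivial_iff_two_le.mpr hn
  have hne1 (i : Fin n) : i ≠ i + 1 := by
    simp only [ne_eq, left_eq_add, Fin.one_eq_zero_iff]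
    omega
  have hrow (i : Fin n) : A i i + A i (i + 1) = 0 := by
    rw [← hsum i]
    refine (Fintype.sum_eq_add _ _ (hne1 i) ?_).symm
    rintro k ⟨h₁, h₂⟩
    exact hpat i k h₁.symm h₂
  have hcol (j : Fin n) : A (j + 1) (j + 1) * w (j + 1) = A j j * w j := by
    have h := congrFun hker (j + 1)
    simp only [Matrix.mulVec, dotProduct, Matrix.transpose_apply, Pi.zero_apply] at h
    rw [Fintype.sum_eq_add _ _ (hne1 j)] at h
    · linear_combination h - w j * hrow j
    · rintro k ⟨h₁, h₂⟩
      rw [hpat k (j + 1) h₂ fun e => h₁ (add_right_cancel e).symm, zero_mul]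
  by_contra! ⟨hsingle, k, hk⟩
  have hzero (i : Fin n) (hi : w i ≠ 0) : ∀ l, A i l = 0 := by
    have hii : A i i = 0 := by
      have h := Fin.apply_eq_of_apply_add_one_eq (f := fun i => A i i * w i) hcol i k
      simpa [hk, hi] using h
    intro l
    by_cases h₁ : i = l
    · rwa [← h₁]
    by_cases h₂ : l = i + 1
    · rw [h₂]
      linarith [hrow i]
    · exact hpat i l h₁ h₂
  obtain ⟨i, hi⟩ : ∃ i, w i ≠ 0 := by
    by_contra! h
    simpa [h] using hw.2
  obtain ⟨j, hji, hj⟩ : ∃ j, j ≠ i ∧ w j ≠ 0 := by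
    by_contra! h
    have hwi : w i = 1 := by rw [← hw.2, Fintype.sum_eq_single i h]
    refine hsingle i (funext fun l => ?_)
    rcases eq_or_ne l i with rfl | hl
    · simp [hwi]
    · simp [h l hl, hl]
  have hdvd := X_sq_dvd_charpoly_of_rows_eq_zero A hji (hzero j hj) (hzero i hi)
  have hle : 2 ≤ Polynomial.rootMultiplicity 0 A.charpoly := by
    rw [Polynomial.le_rootMultiplicity_iff A.charpoly_monic.ne_zero]
    simpa using hdvd
  have hone : Polynomial.rootMultiplicity 0 A.charpoly = 1 := hsimple
  omega
end
end

section
/- Let G = (V,E) be a rooted simple directed graph on n vertices. If 𝔸_G(w) is nonempty for every w ∈ Sp[V], then G is a complete directed graph, i.e. i→j ∈ E for every ordered pair of distinct vertices i, j. -/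
open Matrix Finset
open scoped Classical

noncomputable section

open Polynomial in
/-- If the rows of `A` indexed by `s` vanish, then `X ^ #s` divides the characteristic
polynomial of `A`. -/
theorem X_pow_card_dvd_charpoly_of_rows_eq_zero {ι R : Type*} [Fintype ι] [DecidableEq ι]
    [CommRing R] (A : Matrix ι ι R) (s : Finset ι) (hs : ∀ i ∈ s, ∀ j, A i j = 0) :
    (X : R[X]) ^ #s ∣ A.charpoly := by
  have h : A.charmatrix = diagonal (fun k => if k ∈ s then (X : R[X]) else 1) *
      Matrix.of fun k l => if k ∈ s then (1 : Matrix ι ι R[X]) k l else A.charmatrix k l := by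
    ext1 k l
    by_cases hk : k ∈ s
    · by_cases hkl : k = l
      · simp [diagonal_mul, charmatrix_apply, hkl, hkl ▸ hk, hkl ▸ hs k hk]
      · simp [diagonal_mul, charmatrix_apply, hk, hs k hk, hkl]
    · simp [diagonal_mul, hk]
  rw [Matrix.charpoly, h, det_mul, det_diagonal]
  apply Dvd.dvd.mul_right
  rw [Finset.prod_ite_mem, Finset.univ_inter, Finset.prod_const]

/-- A matrix with two vanishing rows does not have `0` as a simple eigenvalue. -/
theorem not_simpleZeroEig_of_two_rows_eq_zero {n : ℕ} (A : Matrix (Fin n) (Fin n) ℝ)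
    {i j : Fin n} (hij : i ≠ j) (hi : ∀ k, A i k = 0) (hj : ∀ k, A j k = 0) :
    ¬ SimpleZeroEig A := by
  intro h
  have hdvd := X_pow_card_dvd_charpoly_of_rows_eq_zero A {i, j} (by simp [hi, hj])
  rw [Finset.card_pair hij] at hdvd
  have hle : 2 ≤ Polynomial.rootMultiplicity 0 A.charpoly :=
    (Polynomial.le_rootMultiplicity_iff A.charpoly_monic.ne_zero).2 (by simpa using hdvd)
  rw [SimpleZeroEig] at h
  omega

/-- Corollary 2: if `𝔸_G(w)` is nonempty for every `w` in the simplex, then the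
rooted simple digraph `G` is complete. -/
theorem complete_of_all_weights_feasible
    (n : ℕ) (hn : 1 ≤ n) (E : Fin n → Fin n → Prop) (hsimple : ∀ i, ¬ E i i)
    (hrooted : Rooted E)
    (hall : ∀ w : Fin n → ℝ, MemSimplex w → ∃ A, Feasible E w A) :
    ∀ i j : Fin n, i ≠ j → E i j := by
  intro i j hij
  by_contra hE
  obtain ⟨A, ⟨hnonneg, hrow⟩, hpat, hsimp, hw⟩ :=
    hall (fun k => (if k = i then 1 / 2 else 0) + if k = j then 1 / 2 else 0)
      ⟨fun k => by positivity, by rw [Finset.sum_add_distrib]; simp; norm_num⟩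
  have hcol : ∀ k, A i k + A j k = 0 := by
    intro k
    have hk := congrFun hw k
    simp only [mulVec, dotProduct, transpose_apply, mul_add, mul_ite, mul_zero,
      Finset.sum_add_distrib, Finset.sum_ite_eq', Finset.mem_univ, if_true,
      Pi.zero_apply] at hk
    linarith
  have hAij : A i j = 0 := hpat i j hij hE
  have hoff : ∀ k, k ≠ i → A i k = 0 := by
    intro k hki
    by_cases hkj : k = j
    · rw [hkj, hAij]
    · linarith [hcol k, hnonneg i k (Ne.symm hki), hnonneg j k (Ne.symm hkj)]
  have hi : ∀ k, A i k = 0 := by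
    intro k
    by_cases hki : k = i
    · rw [hki, ← hrow i]
      exact (Finset.sum_eq_single i (fun b _ hb => hoff b hb) (by simp)).symm
    · exact hoff k hki
  have hj : ∀ k, A j k = 0 := fun k => by linarith [hcol k, hi k]
  exact not_simpleZeroEig_of_two_rows_eq_zero A hij hi hj hsimp
end
end

section
/- Let G be a simple directed graph on n vertices, let w ∈ Sp(V), and let G_1,…,G_k be the cycles of G with associated ISMs C_1,…,C_k. Then for each index i, the ray {α C_i : α ≥ 0} is an extreme ray of the convex cone Co[C_1,…,C_k]: there exists no set of nonnegative coefficients α_j (j ≠ i) such that C_i = ∑_{j≠i} α_j C_j. -/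
open Matrix Finset
open scoped Classical

noncomputable section

/-- `c` is (the edge relation of) a cycle of the digraph `E`: there are distinct
vertices `v 0, …, v (m+1)` (hence at least two of them), each edge `v t → v (t+1)`
(indices cyclic) is an edge of `E`, and the edges of `c` are exactly these edges. -/
def IsCycleOf {n : ℕ} (E : Fin n → Fin n → Prop) (c : Fin n → Fin n → Prop) : Prop :=
  ∃ (m : ℕ) (v : Fin (m + 2) → Fin n), Function.Injective v ∧
    (∀ t, E (v t) (v (t + 1))) ∧
    ∀ i j, c i j ↔ ∃ t, v t = i ∧ v (t + 1) = j

/-- The ISM associated with a cycle `c` and the weight vector `w`: off-diagonal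
entries are `1 / w j` on the edges of the cycle and `0` otherwise, and the diagonal
entries are chosen so that every row sums to zero. -/
noncomputable def cycleISM {n : ℕ} (w : Fin n → ℝ) (c : Fin n → Fin n → Prop) :
    Matrix (Fin n) (Fin n) ℝ :=
  Matrix.of fun i j =>
    if i = j then -(∑ l ∈ Finset.univ.erase i, if c i l then (w i)⁻¹ else 0)
    else if c i j then (w i)⁻¹ else 0

/-- A nonempty set of residues closed under adding one contains every residue. -/
theorem Fin.forall_of_closed_add_one {m : ℕ} {P : Fin (m + 2) → Prop} {a : Fin (m + 2)}
    (ha : P a) (hP : ∀ t, P t → P (t + 1)) (t : Fin (m + 2)) : P t := by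
  have key : ∀ k, P (a + k) := by
    intro k
    induction k using Fin.induction with
    | zero => simpa using ha
    | succ k ih => simpa [add_assoc, Fin.coeSucc_eq_succ] using hP _ ih
  simpa using key (t - a)

/-- A cycle has at least one edge. -/
theorem IsCycleOf.exists_edge {n : ℕ} {E c : Fin n → Fin n → Prop} (hc : IsCycleOf E c) :
    ∃ i j, c i j := by
  obtain ⟨m, v, -, -, hv⟩ := hc
  exact ⟨v 0, v (0 + 1), (hv _ _).2 ⟨0, rfl, rfl⟩⟩

/-- The edges of a cycle of `E` are edges of `E`. -/
theorem IsCycleOf.edge {n : ℕ} {E c : Fin n → Fin n → Prop} (hc : IsCycleOf E c)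
    {i j : Fin n} (h : c i j) : E i j := by
  obtain ⟨m, v, -, hE, hv⟩ := hc
  obtain ⟨t, rfl, rfl⟩ := (hv _ _).1 h
  exact hE t

/-- A cycle that is contained in another cycle is equal to it. -/
theorem IsCycleOf.eq_of_le {n : ℕ} {E c d : Fin n → Fin n → Prop} (hc : IsCycleOf E c)
    (hd : IsCycleOf E d) (hcd : ∀ i j, c i j → d i j) : c = d := by
  obtain ⟨m, v, -, -, hv⟩ := hc
  obtain ⟨m', u, hu, -, hu'⟩ := hd
  have step : ∀ s t, v s = u t → v (s + 1) = u (t + 1) := by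
    intro s t hst
    obtain ⟨t', h1, h2⟩ := (hu' _ _).1 (hcd _ _ ((hv _ _).2 ⟨s, rfl, rfl⟩))
    obtain rfl : t' = t := hu (h1.trans hst)
    exact h2.symm
  obtain ⟨a, ha, -⟩ := (hu' _ _).1 (hcd _ _ ((hv _ _).2 ⟨0, rfl, rfl⟩))
  have hall : ∀ t, ∃ s, v s = u t :=
    Fin.forall_of_closed_add_one ⟨0, ha.symm⟩ fun t ⟨s, hs⟩ => ⟨s + 1, step s t hs⟩
  ext i j
  refine ⟨hcd i j, fun h => ?_⟩
  obtain ⟨t, rfl, rfl⟩ := (hu' _ _).1 h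
  obtain ⟨s, hs⟩ := hall t
  exact (hv _ _).2 ⟨s, hs, step s t hs⟩

theorem cycleISM_apply_of_ne {n : ℕ} (w : Fin n → ℝ) (c : Fin n → Fin n → Prop)
    {i j : Fin n} (hij : i ≠ j) : cycleISM w c i j = if c i j then (w i)⁻¹ else 0 := by
  simp [cycleISM, hij]

/-- Proposition 2 (second part): each ray `{α C_i : α ≥ 0}` is an extreme ray of the
cone `Co[C_1,…,C_k]`: no `C_i` is a nonnegative combination of the other `C_j`'s. -/
theorem cycleISM_extreme_ray
    (n k : ℕ) (hn : 1 ≤ n)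
    (E : Fin n → Fin n → Prop) (hsimple : ∀ i, ¬ E i i)
    (w : Fin n → ℝ) (hw : ∀ i, 0 < w i) (hw1 : ∑ i, w i = 1)
    (Gc : Fin k → Fin n → Fin n → Prop)
    (hcyc : ∀ t, IsCycleOf E (Gc t)) (hinj : Function.Injective Gc)
    (hall : ∀ c, IsCycleOf E c → ∃ t, Gc t = c) :
    ∀ t : Fin k, ¬ ∃ α : Fin k → ℝ, (∀ s, 0 ≤ α s) ∧
      cycleISM w (Gc t) = ∑ s ∈ Finset.univ.erase t, α s • cycleISM w (Gc s) := by
  rintro t ⟨α, hα, h⟩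
  have hne : ∀ s i j, Gc s i j → i ≠ j := fun s i j hs hij =>
    hsimple i (by simpa [← hij] using (hcyc s).edge hs)
  have happ : ∀ i j, i ≠ j → (if Gc t i j then (w i)⁻¹ else 0) =
      ∑ s ∈ Finset.univ.erase t, α s * if Gc s i j then (w i)⁻¹ else 0 := by
    intro i j hij
    have := congrFun (congrFun h i) j
    simpa only [Matrix.sum_apply, Matrix.smul_apply, smul_eq_mul,
      cycleISM_apply_of_ne w _ hij] using this
  obtain ⟨i, j, hij⟩ := (hcyc t).exists_edge
  obtain ⟨s, hs, hs0⟩ : ∃ s ∈ Finset.univ.erase t,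
      (α s * if Gc s i j then (w i)⁻¹ else 0) ≠ 0 := by
    apply Finset.exists_ne_zero_of_sum_ne_zero
    rw [← happ i j (hne t i j hij), if_pos hij]
    exact (inv_pos.2 (hw i)).ne'
  have hαs : 0 < α s := lt_of_le_of_ne (hα s) (left_ne_zero_of_mul hs0).symm
  refine Finset.ne_of_mem_erase hs (hinj ((hcyc s).eq_of_le (hcyc t) fun a b hab => ?_))
  by_contra hnot
  have hsum := happ a b (hne s a b hab)
  rw [if_neg hnot] at hsum
  have hpos : 0 < ∑ s ∈ Finset.univ.erase t, α s * if Gc s a b then (w a)⁻¹ else 0 := by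
    refine Finset.sum_pos' (fun r _ => mul_nonneg (hα r) ?_) ⟨s, hs, ?_⟩
    · split_ifs
      exacts [(inv_pos.2 (hw a)).le, le_rfl]
    · rw [if_pos hab]
      exact mul_pos hαs (inv_pos.2 (hw a))
  exact hpos.ne hsum
end
end

section
/- Let G be an acyclic simple directed graph on n vertices (G contains no directed cycle) and let w ∈ Sp(V). Then Â_G(w) = {0}, i.e. the only matrix A ∈ 𝔸_G with Aᵀ w = 0 is the zero matrix. -/
open Matrix Finset
open scoped Classical

noncomputable section

/-- If column `i` of an ISM `A` vanishes off the diagonal and `Aᵀ w = 0` with `w i > 0`, then row `i`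
of `A` vanishes. -/
theorem IsISM.row_eq_zero {n : ℕ} {A : Matrix (Fin n) (Fin n) ℝ} (hA : IsISM A)
    {w : Fin n → ℝ} (hAw : Aᵀ *ᵥ w = 0) {i : Fin n} (hwi : 0 < w i)
    (hcol : ∀ j, j ≠ i → A j i = 0) (k : Fin n) : A i k = 0 := by
  have hdiag : A i i = 0 := by
    have h : ∑ j, A j i * w j = 0 := congrFun hAw i
    rw [Finset.sum_eq_single i (fun j _ hj => by rw [hcol j hj, zero_mul]) (by simp)] at h
    exact (mul_eq_zero.mp h).resolve_right hwi.ne'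
  have hnonneg : ∀ j ∈ Finset.univ, 0 ≤ A i j := fun j _ => by
    rcases eq_or_ne i j with rfl | hj
    · exact hdiag.ge
    · exact hA.1 i j hj
  exact (Finset.sum_eq_zero_iff_of_nonneg hnonneg).mp (hA.2 i) k (Finset.mem_univ k)

/-- Lemma 3: if `G` is acyclic (it contains no directed cycle) and `w` lies in the
interior of the simplex, then the only relaxed `w`-feasible dynamics is `A = 0`. -/
theorem acyclic_relaxed_feasible_eq_zero
    (n : ℕ) (hn : 1 ≤ n) (E : Fin n → Fin n → Prop) (hsimple : ∀ i, ¬ E i i)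
    (hacyclic : ∀ i, ¬ Relation.TransGen E i i)
    (w : Fin n → ℝ) (hw : ∀ i, 0 < w i) (hw1 : ∑ i, w i = 1) :
    ∀ A : Matrix (Fin n) (Fin n) ℝ, IsISM A → InPattern E A → Aᵀ *ᵥ w = 0 → A = 0 := by
  intro A hA hpat hAw
  have : Std.Irrefl (Relation.TransGen E) := ⟨hacyclic⟩
  have hwf : WellFounded (Relation.TransGen E) := Finite.wellFounded_of_trans_of_irrefl _
  have hrow : ∀ i k, A i k = 0 := fun i => by
    induction i using hwf.induction with
    | _ i ih =>
      refine hA.row_eq_zero hAw (hw i) fun j hj => ?_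
      by_cases hE : E j i
      · exact ih j (.single hE) i
      · exact hpat j i hj hE
  ext i k
  exact hrow i k
end
end
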